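/- Let A and B be finite sets of integers with |A| ≥ 2, |B| ≥ 2, and A ≠ B. Then |A +̂ B| ≥ |A| + |B| - 2. -/

import Mathlib

/-- The restricted sumset of two finite sets of integers:
`A +̂ B = {a + b : a ∈ A, b ∈ B, a ≠ b}`. -/
def restrictedSumset (A B : Finset ℤ) : Finset ℤ :=
  ((A ×ˢ B).filter fun p => p.1 ≠ p.2).image fun p => p.1 + p.2

theorem aux_mem (A B : Finset ℤ) (s : ℤ) :
    s ∈ restrictedSumset A B ↔ ∃ x ∈ A, ∃ y ∈ B, x ≠ y ∧ x + y = s := by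
  simp only [restrictedSumset, Finset.mem_image, Finset.mem_filter, Finset.mem_product,
    Prod.exists]
  constructor
  · rintro ⟨x, y, ⟨⟨h1, h2⟩, h3⟩, h4⟩
    exact ⟨x, h1, y, h2, h3, h4⟩
  · rintro ⟨x, h1, y, h2, h3, h4⟩
    exact ⟨x, y, ⟨⟨h1, h2⟩, h3⟩, h4⟩

theorem aux_comm (A B : Finset ℤ) : restrictedSumset A B = restrictedSumset B A := by
  ext s
  rw [aux_mem, aux_mem]
  constructor
  · rintro ⟨x, h1, y, h2, h3, h4⟩
    exact ⟨y, h2, x, h1, h3.symm, by omega⟩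
  · rintro ⟨x, h1, y, h2, h3, h4⟩
    exact ⟨y, h2, x, h1, h3.symm, by omega⟩

theorem aux_card (S X Y : Finset ℤ) (a m : ℤ) (hX : ∀ x ∈ X, x ≤ m ∧ a + x ∈ S)
    (hY : ∀ y ∈ Y, a ≤ y ∧ m + y ∈ S) : X.card + Y.card ≤ S.card + 1 := by
  have h1 : (X.image (fun x => a + x)).card = X.card :=
    Finset.card_image_of_injective _ (add_right_injective a)
  have h2 : (Y.image (fun x => m + x)).card = Y.card :=
    Finset.card_image_of_injective _ (add_right_injective m)
  have h3 := Finset.card_union_add_card_inter (X.image (fun x => a + x)) (Y.image (fun x => m + x))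
  have h4 : (X.image (fun x => a + x) ∪ Y.image (fun x => m + x)).card ≤ S.card := by
    apply Finset.card_le_card
    intro s hs
    simp only [Finset.mem_union, Finset.mem_image] at hs
    rcases hs with ⟨x, hx, rfl⟩ | ⟨x, hx, rfl⟩
    · exact (hX x hx).2
    · exact (hY x hx).2
  have h5 : (X.image (fun x => a + x) ∩ Y.image (fun x => m + x)).card ≤ 1 := by
    rw [← Finset.card_singleton (a + m)]
    apply Finset.card_le_card
    intro s hs
    simp only [Finset.mem_inter, Finset.mem_image] at hs
    obtain ⟨⟨x, hx, rfl⟩, ⟨y, hy, h⟩⟩ := hs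
    have := (hX x hx).1
    have := (hY y hy).1
    rw [Finset.mem_singleton]
    omega
  omega

theorem aux_min (A B : Finset ℤ) (a m : ℤ) (ha : a ∈ A) (hm : m ∈ B)
    (hal : ∀ x ∈ A, a ≤ x) (hmu : ∀ x ∈ B, x ≤ m) (hlt : ∀ x ∈ B, a < x) :
    A.card + B.card - 2 ≤ (restrictedSumset A B).card := by
  have := aux_card (restrictedSumset A B) B (A.erase m) a m
    (fun x hx => ⟨hmu x hx, (aux_mem _ _ _).2 ⟨a, ha, x, hx, (hlt x hx).ne, rfl⟩⟩)
    (fun y hy => ⟨hal y (Finset.mem_of_mem_erase hy), (aux_mem _ _ _).2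
      ⟨y, Finset.mem_of_mem_erase hy, m, hm, Finset.ne_of_mem_erase hy, add_comm _ _⟩⟩)
  have := Finset.pred_card_le_card_erase (s := A) (a := m)
  omega

theorem aux_max (A B : Finset ℤ) (a m : ℤ) (ha : a ∈ B) (hm : m ∈ A)
    (hal : ∀ x ∈ B, a ≤ x) (hmu : ∀ x ∈ A, x ≤ m) (hlt : ∀ x ∈ B, x < m) :
    A.card + B.card - 2 ≤ (restrictedSumset A B).card := by
  have := aux_card (restrictedSumset A B) (A.erase a) B a m
    (fun y hy => ⟨hmu y (Finset.mem_of_mem_erase hy), (aux_mem _ _ _).2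
      ⟨y, Finset.mem_of_mem_erase hy, a, ha, Finset.ne_of_mem_erase hy, add_comm _ _⟩⟩)
    (fun x hx => ⟨hal x hx, (aux_mem _ _ _).2 ⟨m, hm, x, hx, (hlt x hx).ne', rfl⟩⟩)
  have := Finset.pred_card_le_card_erase (s := A) (a := a)
  omega

theorem aux_both (A B : Finset ℤ) (c x : ℤ) (hA : c ∈ A) (hB : c ∈ B) (hx : x ∈ A ∪ B)
    (hne : x ≠ c) : c + x ∈ restrictedSumset A B := by
  rw [aux_mem]
  rcases Finset.mem_union.1 hx with h | h
  · exact ⟨x, h, c, hB, hne, add_comm _ _⟩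
  · exact ⟨c, hA, x, h, hne.symm, rfl⟩

theorem stmt_9 (A B : Finset ℤ) (hA : 2 ≤ A.card) (hB : 2 ≤ B.card)
    (hAB : A ≠ B) :
    A.card + B.card - 2 ≤ (restrictedSumset A B).card := by
  have nA : A.Nonempty := Finset.card_pos.1 (by omega)
  have nB : B.Nonempty := Finset.card_pos.1 (by omega)
  obtain ⟨a, ha, hal⟩ := A.exists_min_image id nA
  obtain ⟨b, hb, hbl⟩ := B.exists_min_image id nB
  obtain ⟨m, hm, hmu⟩ := A.exists_max_image id nA
  obtain ⟨n, hn, hnu⟩ := B.exists_max_image id nB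
  simp only [id] at hal hbl hmu hnu
  rcases lt_trichotomy a b with h | h | h
  · exact aux_min A B a n ha hn hal hnu (fun x hx => h.trans_le (hbl x hx))
  · rcases lt_trichotomy m n with h' | h' | h'
    · rw [aux_comm, add_comm]
      exact aux_max B A a n ha hn hal hnu (fun x hx => (hmu x hx).trans_lt h')
    · subst h h'
      have h1 := aux_card (restrictedSumset A B) ((A ∪ B).erase a) ((A ∪ B).erase m) a m
        (fun x hx => by
          have hx' := Finset.mem_of_mem_erase hx
          refine ⟨?_, aux_both A B a x ha hb hx' (Finset.ne_of_mem_erase hx)⟩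
          rcases Finset.mem_union.1 hx' with h | h
          · exact hmu x h
          · exact hnu x h)
        (fun x hx => by
          have hx' := Finset.mem_of_mem_erase hx
          refine ⟨?_, aux_both A B m x hm hn hx' (Finset.ne_of_mem_erase hx)⟩
          rcases Finset.mem_union.1 hx' with h | h
          · exact hal x h
          · exact hbl x h)
      have h2 := Finset.pred_card_le_card_erase (s := A ∪ B) (a := a)
      have h3 := Finset.pred_card_le_card_erase (s := A ∪ B) (a := m)
      have h4 : A.card ≤ (A ∪ B).card := Finset.card_le_card Finset.subset_union_left
      have h5 : B.card ≤ (A ∪ B).card := Finset.card_le_card Finset.subset_union_right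
      have h6 : ¬ ((A ∪ B).card ≤ A.card ∧ (A ∪ B).card ≤ B.card) := by
        rintro ⟨u, v⟩
        have e1 := Finset.eq_of_subset_of_card_le Finset.subset_union_left u
        have e2 := Finset.eq_of_subset_of_card_le Finset.subset_union_right v
        exact hAB (e1.trans e2.symm)
      omega
    · exact aux_max A B b m hb hm hbl hmu (fun x hx => (hnu x hx).trans_lt h')
  · rw [aux_comm, add_comm]
    exact aux_min B A b m hb hm hbl hmu (fun x hx => h.trans_le (hal x hx))
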